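/- Let k ≥ 2 and k²+1 ≤ b < c ≤ k²+k be integers, and suppose x = [0;k,a_2,a_3,…] is a Trott number in both base b and base c. Let m be the number of digits of the second partial quotient a_2 in base c. Then m > k·log k (natural logarithm). -/

import Mathlib

open Filter Topology

/-- Number of digits of `a` in base `b`. -/
def digLen (b a : ℕ) : ℕ := (Nat.digits b a).length

/-- Value of the finite continued fraction `[0; a₁, a₂, …, aₙ]`. -/
noncomputable def cfVal : List ℕ → ℝ
  | [] => 0
  | (h :: t) => 1 / ((h : ℝ) + cfVal t)

/-- `a` witnesses that `x` is a Trott number in base `b`: the `a i` (indexed from 0)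
are positive, `x` is the value of the infinite continued fraction `[0; a 0, a 1, …]`,
and the base-`b` expansion of `x` is the concatenation of the base-`b` digit strings
of the partial quotients. -/
def IsTrottWith (b : ℕ) (x : ℝ) (a : ℕ → ℕ) : Prop :=
  (∀ i, 0 < a i) ∧
  Tendsto (fun n => cfVal ((List.range n).map a)) atTop (𝓝 x) ∧
  x = ∑' i : ℕ, (a i : ℝ) / (b : ℝ) ^ (∑ j ∈ Finset.range (i + 1), digLen b (a j))

/-- `x` is a Trott number in base `b`. -/
def IsTrott (b : ℕ) (x : ℝ) : Prop := ∃ a, IsTrottWith b x a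

/-- The set of Trott numbers in base `b`. -/
def TrottSet (b : ℕ) : Set ℝ := {x | IsTrott b x}

theorem cfVal_mem_Icc {l : List ℕ} (hl : ∀ i ∈ l, 0 < i) : cfVal l ∈ Set.Icc (0 : ℝ) 1 := by
  induction l with
  | nil => simp [cfVal]
  | cons h t ih =>
    have ht := ih fun i hi => hl i (List.mem_cons_of_mem _ hi)
    have hh : (1 : ℝ) ≤ h := by exact_mod_cast hl h List.mem_cons_self
    have hpos : (1 : ℝ) ≤ h + cfVal t := by linarith [ht.1]
    simp only [cfVal, Set.mem_Icc]
    exact ⟨by positivity, by rw [div_le_one (by linarith)]; exact hpos⟩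

/-- The limit of a continued fraction is determined by its first two partial quotients up to a
second complete quotient between `a 1` and `a 1 + 1`. -/
theorem exists_complete_quotient {a : ℕ → ℕ} {x : ℝ} (ha : ∀ i, 0 < a i)
    (hx : Tendsto (fun n => cfVal ((List.range n).map a)) atTop (𝓝 x)) :
    ∃ A ∈ Set.Icc (a 1 : ℝ) (a 1 + 1), x = A / (a 0 * A + 1) := by
  have ha1 : (1 : ℝ) ≤ a 1 := by exact_mod_cast ha 1
  have hclosed : IsClosed
      ((fun A : ℝ => A / (a 0 * A + 1)) '' Set.Icc (a 1 : ℝ) (a 1 + 1)) := by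
    refine (isCompact_Icc.image_of_continuousOn ?_).isClosed
    refine continuousOn_id.div (by fun_prop) fun A hA => ?_
    have : (0 : ℝ) ≤ A := by linarith [hA.1]
    positivity
  have hmem := hclosed.mem_of_tendsto ((tendsto_add_atTop_iff_nat 2).2 hx)
    (Eventually.of_forall fun n => ?_)
  · obtain ⟨A, hA, h⟩ := hmem
    exact ⟨A, hA, h.symm⟩
  · have hy := cfVal_mem_Icc (l := (List.range n).map fun i => a (i + 2))
      (by simp only [List.mem_map]; rintro _ ⟨i, -, rfl⟩; exact ha _)
    refine ⟨a 1 + cfVal ((List.range n).map fun i => a (i + 2)),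
      ⟨by linarith [hy.1], by linarith [hy.2]⟩, ?_⟩
    have hpos : (0 : ℝ) < a 1 + cfVal ((List.range n).map fun i => a (i + 2)) := by
      linarith [hy.1]
    have hl : (List.range (n + 2)).map a
        = a 0 :: a 1 :: (List.range n).map fun i => a (i + 2) := by
      simp [List.range_succ_eq_map, Function.comp_def]
    simp only [hl, cfVal]
    field_simp

/-- The first two digit blocks of a concatenated base-`b` expansion determine it up to one unit in
the last place. -/
theorem exists_digit_tail {b : ℕ} (hb : 2 ≤ b) (a : ℕ → ℕ) :
    ∃ t ∈ Set.Icc (0 : ℝ) 1, (b : ℝ) ^ (digLen b (a 0) + digLen b (a 1)) *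
      (∑' i : ℕ, (a i : ℝ) / (b : ℝ) ^ (∑ j ∈ Finset.range (i + 1), digLen b (a j)))
      = a 0 * (b : ℝ) ^ digLen b (a 1) + a 1 + t := by
  have hb0 : (0 : ℝ) < b := by positivity
  set S : ℕ → ℕ := fun n => ∑ j ∈ Finset.range n, digLen b (a j) with hS
  set f : ℕ → ℝ := fun i => (a i : ℝ) / (b : ℝ) ^ S (i + 1) with hf
  have hf0 : ∀ i, 0 ≤ f i := fun i => by positivity
  have hstep : ∀ i, f i ≤ 1 / (b : ℝ) ^ S i - 1 / (b : ℝ) ^ S (i + 1) := by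
    intro i
    have hlt : (a i : ℝ) + 1 ≤ (b : ℝ) ^ digLen b (a i) := by
      exact_mod_cast Nat.lt_base_pow_length_digits (m := a i) (show 1 < b from hb)
    have hSs : S (i + 1) = S i + digLen b (a i) := Finset.sum_range_succ _ _
    have h1 : 1 / (b : ℝ) ^ S i = (b : ℝ) ^ digLen b (a i) / (b : ℝ) ^ S (i + 1) := by
      rw [hSs, pow_add]
      field_simp
    rw [h1, ← sub_div]
    exact div_le_div_of_nonneg_right (by linarith) (by positivity)
  have hpart : ∀ N n, ∑ i ∈ Finset.range n, f (i + N) ≤ 1 / (b : ℝ) ^ S N := by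
    intro N n
    have : ∑ i ∈ Finset.range n, f (i + N) ≤ 1 / (b : ℝ) ^ S N - 1 / (b : ℝ) ^ S (n + N) := by
      induction n with
      | zero => simp
      | succ n ih =>
        rw [Finset.sum_range_succ]
        have := hstep (n + N)
        rw [show n + 1 + N = n + N + 1 by ring]
        linarith
    have hpos : 0 ≤ 1 / (b : ℝ) ^ S (n + N) := by positivity
    linarith
  have hsum : Summable f := summable_of_sum_range_le hf0 fun n => by simpa using hpart 0 n
  have hsplit := hsum.sum_add_tsum_nat_add 2
  have htail : ∑' i, f (i + 2) ≤ 1 / (b : ℝ) ^ S 2 :=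
    Real.tsum_le_of_sum_range_le (fun i => hf0 _) (hpart 2)
  have hS2 : digLen b (a 0) + digLen b (a 1) = S 2 := by simp [hS, Finset.sum_range_succ]
  have hS1 : S 1 = digLen b (a 0) := by simp [hS]
  refine ⟨(b : ℝ) ^ S 2 * ∑' i, f (i + 2),
    ⟨mul_nonneg (by positivity) (tsum_nonneg fun i => hf0 _), ?_⟩, ?_⟩
  · rw [le_div_iff₀ (by positivity)] at htail
    linarith
  · rw [hS2, ← hsplit, mul_add]
    congr 1
    simp only [Finset.sum_range_succ, Finset.sum_range_zero, hf, zero_add, Nat.reduceAdd]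
    rw [← hS2, hS1, pow_add]
    field_simp

theorem log_two_bases_bound {k m : ℕ} (hk : 2 ≤ k)
    (h : ((k : ℝ) ^ 2 - k + 1) / k ≤ (((k : ℝ) ^ 2 + k) / (k ^ 2 + 1)) ^ m) :
    (k : ℝ) * Real.log k < m := by
  have hk2 : (2 : ℝ) ≤ k := by exact_mod_cast hk
  have hnum : (0 : ℝ) < (k : ℝ) ^ 2 - k + 1 := by nlinarith
  have hlog := Real.log_le_log (by positivity) h
  rw [Real.log_pow] at hlog
  have hq : Real.log (((k : ℝ) ^ 2 + k) / (k ^ 2 + 1)) ≤ (k - 1) / (k ^ 2 + 1) := by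
    refine (Real.log_le_sub_one_of_pos (by positivity)).trans_eq ?_
    field_simp
    ring
  have hu : Real.log k - (k - 1) / ((k : ℝ) ^ 2 - k + 1) ≤
      Real.log (((k : ℝ) ^ 2 - k + 1) / k) := by
    have h1 := Real.log_le_sub_one_of_pos
      (show (0 : ℝ) < k / (((k : ℝ) ^ 2 - k + 1) / k) by positivity)
    rw [Real.log_div (by positivity) (by positivity)] at h1
    have h2 : (k : ℝ) / (((k : ℝ) ^ 2 - k + 1) / k) - 1 = (k - 1) / ((k : ℝ) ^ 2 - k + 1) := by
      rw [div_div_eq_mul_div, div_sub_one hnum.ne']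
      ring
    linarith
  have hL : (k : ℝ) ≤ (k + 1) * Real.log k := by
    rcases hk.eq_or_lt with rfl | h3
    · push_cast
      linarith [Real.log_two_gt_d9]
    · have h3' : (3 : ℝ) ≤ k := by exact_mod_cast h3
      have : 1 ≤ Real.log k := by
        rw [Real.le_log_iff_exp_le (by positivity)]
        linarith [Real.exp_one_lt_d9]
      nlinarith
  have hmain : Real.log k - (k - 1) / ((k : ℝ) ^ 2 - k + 1) ≤ m * ((k - 1) / (k ^ 2 + 1)) :=
    hu.trans (hlog.trans (mul_le_mul_of_nonneg_left hq (by positivity)))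
  have hmul : (Real.log k - (k - 1) / ((k : ℝ) ^ 2 - k + 1)) * (k ^ 2 + 1) ≤ m * (k - 1) := by
    rw [← mul_div_assoc, le_div_iff₀ (by positivity)] at hmain
    exact hmain
  have hk' : (k - 1) / ((k : ℝ) ^ 2 - k + 1) * (k ^ 2 + 1) < k := by
    rw [div_mul_eq_mul_div, div_lt_iff₀ hnum]
    nlinarith
  have : (k : ℝ) * Real.log k * (k - 1) < m * (k - 1) := by nlinarith
  exact lt_of_mul_lt_mul_right this (by linarith)

theorem two_bases_ratio_bound {k b c A q : ℝ} (hk : 2 ≤ k) (hb : k ^ 2 + 1 ≤ b)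
    (hc : c ≤ k ^ 2 + k) (hq : b ≤ q) (hA : b ≤ A) :
    (k ^ 2 - k + 1) / k * (((c - k ^ 2) * A - k) * (q + 1)) ≤
      b * ((b - k ^ 2) * A - k) * q := by
  have hAk : k ^ 2 + 1 ≤ A := hb.trans hA
  have hA0 : 0 ≤ A := by nlinarith
  have hq0 : 0 ≤ q := by nlinarith
  have hb0 : 0 ≤ b := by nlinarith
  have hnum : 0 ≤ k ^ 2 - k + 1 := by nlinarith
  have h1 : (c - k ^ 2) * A - k ≤ k * (A - 1) := by
    have : (c - k ^ 2) * A ≤ k * A := mul_le_mul_of_nonneg_right (by linarith) hA0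
    linarith
  have h2 : A - k ≤ (b - k ^ 2) * A - k := by
    have : 1 * A ≤ (b - k ^ 2) * A := mul_le_mul_of_nonneg_right (by linarith) hA0
    linarith
  have h3 : (k ^ 2 - k + 1) * (A - 1) ≤ (A - k) * k ^ 2 := by
    have : 0 ≤ (k - 1) * (A - (k ^ 2 + 1)) := mul_nonneg (by linarith) (by linarith)
    linarith
  have h4 : k ^ 2 * (q + 1) ≤ b * q := by
    have : (k ^ 2 + 1) * q ≤ b * q := mul_le_mul_of_nonneg_right hb hq0
    linarith
  have hAk0 : 0 ≤ A - k := by nlinarith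
  calc (k ^ 2 - k + 1) / k * (((c - k ^ 2) * A - k) * (q + 1))
      ≤ (k ^ 2 - k + 1) / k * ((k * (A - 1)) * (q + 1)) := by gcongr
    _ = (k ^ 2 - k + 1) * (A - 1) * (q + 1) := by field_simp
    _ ≤ (A - k) * k ^ 2 * (q + 1) := by gcongr
    _ = (A - k) * (k ^ 2 * (q + 1)) := by ring
    _ ≤ ((b - k ^ 2) * A - k) * (b * q) := by gcongr; linarith
    _ = b * ((b - k ^ 2) * A - k) * q := by ring

theorem trott_block_equation {k b : ℕ} (hk : 0 < k) (hb : k ^ 2 + 1 ≤ b) {x A : ℝ} {a : ℕ → ℕ}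
    (ha0 : a 0 = k) (hA : 0 ≤ A) (hxA : x = A / (k * A + 1)) (h : IsTrottWith b x a) :
    ∃ t ∈ Set.Icc (0 : ℝ) 1,
      (a 1 + t) * (k * A + 1) = (b : ℝ) ^ digLen b (a 1) * ((b - k ^ 2) * A - k) := by
  have hkb : k < b := by nlinarith
  obtain ⟨t, ht, h1⟩ := exists_digit_tail (b := b) (by omega) a
  refine ⟨t, ht, ?_⟩
  have hd : digLen b k = 1 := by
    simp [digLen, Nat.digits_of_lt b k hk.ne' hkb]
  rw [← h.2.2, ha0, hd, hxA, pow_add, pow_one] at h1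
  have hpos : (0 : ℝ) < k * A + 1 := by positivity
  field_simp at h1
  linarith

/-- If `x = [0; k, a 1, a 2, …]` is Trott in two bases `k²+1 ≤ b < c ≤ k²+k`, and `m` is
the number of digits of the second partial quotient `a 1` in base `c`, then `m > k log k`. -/
theorem trott_two_bases_digit_lower_bound (k b c : ℕ) (hk : 2 ≤ k)
    (hb : k ^ 2 + 1 ≤ b) (hbc : b < c) (hc : c ≤ k ^ 2 + k)
    (x : ℝ) (a : ℕ → ℕ) (ha0 : a 0 = k)
    (hxb : IsTrottWith b x a) (hxc : IsTrottWith c x a)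
    (m : ℕ) (hm : digLen c (a 1) = m) :
    (k : ℝ) * Real.log k < (m : ℝ) := by
  obtain ⟨A, ⟨hA1, -⟩, hxA⟩ := exists_complete_quotient hxb.1 hxb.2.1
  rw [ha0] at hxA
  have ha1 : (1 : ℝ) ≤ a 1 := by exact_mod_cast hxb.1 1
  obtain ⟨t, ⟨ht0, ht1⟩, ht⟩ :=
    trott_block_equation (by omega) hb ha0 (by linarith) hxA hxb
  obtain ⟨u, ⟨hu0, hu1⟩, hu⟩ :=
    trott_block_equation (by omega) (hb.trans hbc.le) ha0 (by linarith) hxA hxc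
  rw [hm] at hu
  have hkR : (2 : ℝ) ≤ k := by exact_mod_cast hk
  have hbR : (k : ℝ) ^ 2 + 1 ≤ b := by exact_mod_cast hb
  have hbcR : (b : ℝ) + 1 ≤ c := by exact_mod_cast hbc
  have hcR : (c : ℝ) ≤ k ^ 2 + k := by exact_mod_cast hc
  have hA0 : 0 < (k : ℝ) * A + 1 := by
    have : 0 ≤ A := by linarith
    positivity
  have hb0 : (0 : ℝ) < b := by nlinarith
  have hb1 : (1 : ℝ) ≤ b := by nlinarith
  have hrA : 0 < ((b : ℝ) - k ^ 2) * A - k := by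
    have : 0 < (a 1 + t) * (k * A + 1) := mul_pos (by linarith) hA0
    rw [ht] at this
    exact pos_of_mul_pos_right this (by positivity)
  have hsr : ((b : ℝ) - k ^ 2) * A - k + A ≤ ((c : ℝ) - k ^ 2) * A - k := by nlinarith
  have hm1 : 1 ≤ m := by
    rw [← hm, Nat.one_le_iff_ne_zero, digLen, Ne, List.length_eq_zero_iff,
      Nat.digits_eq_nil_iff_eq_zero]
    exact (hxb.1 1).ne'
  have hlm : m + 1 ≤ digLen b (a 1) := by
    by_contra! hlt
    have hpow : (b : ℝ) ^ digLen b (a 1) ≤ (c : ℝ) ^ m :=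
      (pow_le_pow_right₀ hb1 (by omega)).trans (pow_le_pow_left₀ hb0.le (by linarith) m)
    have hcm : (b : ℝ) ≤ (c : ℝ) ^ m :=
      (show (b : ℝ) ≤ c by linarith).trans
        (le_self_pow₀ (show (1 : ℝ) ≤ c by linarith) (by omega))
    have h1 : (b : ℝ) ^ digLen b (a 1) * ((b - k ^ 2) * A - k) ≤
        (c : ℝ) ^ m * ((b - k ^ 2) * A - k) := mul_le_mul_of_nonneg_right hpow hrA.le
    have h2 : (c : ℝ) ^ m * ((b - k ^ 2) * A - k + A) ≤ (c : ℝ) ^ m * ((c - k ^ 2) * A - k) :=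
      mul_le_mul_of_nonneg_left hsr (by positivity)
    have h3 : b * A ≤ (c : ℝ) ^ m * A := mul_le_mul_of_nonneg_right hcm (by linarith)
    have h4 : (u - t) * (k * A + 1) ≤ 1 * (k * A + 1) :=
      mul_le_mul_of_nonneg_right (by linarith) hA0.le
    have h5 : ((k : ℝ) ^ 2 + 1) * A ≤ b * A := mul_le_mul_of_nonneg_right hbR (by linarith)
    have h6 : 0 < (k : ℝ) * (k - 1) * A := by
      have : (0 : ℝ) < k - 1 := by linarith
      have : 0 < A := by linarith
      positivity
    nlinarith
  have hab : (b : ℝ) ≤ a 1 := by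
    have hlt : 1 < (Nat.digits b (a 1)).length := by
      change m + 1 ≤ (Nat.digits b (a 1)).length at hlm
      omega
    rw [Nat.lt_digits_length_iff (by nlinarith), pow_one] at hlt
    exact_mod_cast hlt
  have hkey : (b : ℝ) ^ m * (b * ((b - k ^ 2) * A - k) * a 1) ≤
      (c : ℝ) ^ m * ((c - k ^ 2) * A - k) * (a 1 + 1) := by
    have h1 : (b : ℝ) ^ (m + 1) * ((b - k ^ 2) * A - k) ≤ (a 1 + 1) * (k * A + 1) := by
      refine (mul_le_mul_of_nonneg_right (pow_le_pow_right₀ hb1 hlm) hrA.le).trans ?_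
      rw [← ht]
      exact mul_le_mul_of_nonneg_right (by linarith) hA0.le
    have h2 : a 1 * (k * A + 1) ≤ (c : ℝ) ^ m * ((c - k ^ 2) * A - k) := by
      rw [← hu]
      exact mul_le_mul_of_nonneg_right (by linarith) hA0.le
    have h3 := mul_le_mul_of_nonneg_right h1 (show (0 : ℝ) ≤ a 1 by linarith)
    have h4 := mul_le_mul_of_nonneg_right h2 (show (0 : ℝ) ≤ a 1 + 1 by linarith)
    rw [pow_succ] at h3
    linarith
  have hratio := two_bases_ratio_bound hkR hbR hcR hab (hab.trans hA1)
  refine log_two_bases_bound hk (le_trans ?_ (pow_le_pow_left₀ (by positivity)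
    (div_le_div₀ (by positivity) hcR (by positivity) hbR) m))
  rw [div_pow, le_div_iff₀ (by positivity)]
  have hpos : 0 < ((c - k ^ 2) * A - k) * ((a 1 : ℝ) + 1) :=
    mul_pos (by linarith) (by linarith)
  refine le_of_mul_le_mul_right ?_ hpos
  have := mul_le_mul_of_nonneg_left hratio (show (0 : ℝ) ≤ (b : ℝ) ^ m by positivity)
  linarith
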